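/- Let M be a positive integer and q ∈ (1, M+1]. If q ∈ U, i.e., 1 has a unique q-expansion, then for every r ∈ (q, M+1] the Hausdorff dimension of the set U ∩ (q, r) is strictly positive. -/

import Mathlib

open Set MeasureTheory Filter

noncomputable section

/-- The projection `π_q` of a digit sequence (0-indexed): `∑ d i / q^(i+1)`. -/
def piQ (q : ℝ) (d : ℕ → ℕ) : ℝ := ∑' i : ℕ, (d i : ℝ) / q ^ (i + 1)

/-- `d` is a `q`-expansion of `x` over the alphabet `{0,…,M}`. -/
def IsExpansion (M : ℕ) (q x : ℝ) (d : ℕ → ℕ) : Prop :=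
  (∀ i, d i ≤ M) ∧ piQ q d = x

/-- `U'_q`: digit sequences that are the unique `q`-expansion of their projection. -/
def UnivSeqs (M : ℕ) (q : ℝ) : Set (ℕ → ℕ) :=
  {d | (∀ i, d i ≤ M) ∧ ∀ e : ℕ → ℕ, IsExpansion M q (piQ q d) e → e = d}

/-- The set `U = U(M)` of univoque bases: `q ∈ (1, M+1]` such that `1` has a
unique `q`-expansion over `{0,…,M}`. -/
def UnivBases (M : ℕ) : Set ℝ :=
  {q | 1 < q ∧ q ≤ M + 1 ∧ ∃! d : ℕ → ℕ, IsExpansion M q 1 d}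

/-- The Komornik–Loreti constant `q'(M) = min U(M)`. -/
def KL (M : ℕ) : ℝ := sInf (UnivBases M)

/-- `(a, b)` is a connected component of `(q'(M), M+1) \ closure (U(M))`:
an open subinterval whose endpoints do not lie in that (open) set. -/
def CC (M : ℕ) (a b : ℝ) : Prop :=
  a < b ∧ Ioo a b ⊆ Ioo (KL M) (M + 1) \ closure (UnivBases M) ∧
    a ∉ Ioo (KL M) (M + 1) \ closure (UnivBases M) ∧
    b ∉ Ioo (KL M) (M + 1) \ closure (UnivBases M)

/-- `x ∈ [0, M/(q-1)]` has exactly two distinct `q`-expansions. -/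
def HasExactlyTwoExpansions (M : ℕ) (q x : ℝ) : Prop :=
  ∃ c d : ℕ → ℕ, c ≠ d ∧ IsExpansion M q x c ∧ IsExpansion M q x d ∧
    ∀ e : ℕ → ℕ, IsExpansion M q x e → e = c ∨ e = d

/-- `B_2(M)`: bases `q ∈ (1, M+1]` for which some `x ∈ [0, M/(q-1)]` has exactly
two `q`-expansions. -/
def B2 (M : ℕ) : Set ℝ :=
  {q | 1 < q ∧ q ≤ M + 1 ∧
    ∃ x ∈ Icc (0 : ℝ) (M / (q - 1)), HasExactlyTwoExpansions M q x}

/-- Strict lexicographic order on digit sequences. -/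
def seqLt (a b : ℕ → ℕ) : Prop := ∃ n, (∀ i < n, a i = b i) ∧ a n < b n

/-- Lexicographic order on digit sequences. -/
def seqLe (a b : ℕ → ℕ) : Prop := seqLt a b ∨ a = b

/-- A digit sequence is infinite if it does not end with `0^∞` after a last
nonzero digit (in particular `0^∞` is infinite). -/
def IsInfiniteSeq (a : ℕ → ℕ) : Prop := ¬∃ m, a m ≠ 0 ∧ ∀ i > m, a i = 0

/-- `a = α(q)`, the quasi-greedy `q`-expansion of `1`: the lexicographically
largest infinite `q`-expansion of `1`. -/
def IsQuasiGreedy (M : ℕ) (q : ℝ) (a : ℕ → ℕ) : Prop :=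
  IsExpansion M q 1 a ∧ IsInfiniteSeq a ∧
    ∀ b : ℕ → ℕ, IsExpansion M q 1 b → IsInfiniteSeq b → seqLe b a

/-- `b = β(q)`, the greedy `q`-expansion of `1`: the lexicographically largest
`q`-expansion of `1`. -/
def IsGreedy (M : ℕ) (q : ℝ) (b : ℕ → ℕ) : Prop :=
  IsExpansion M q 1 b ∧ ∀ c : ℕ → ℕ, IsExpansion M q 1 c → seqLe c b

/-- `w⁺`: increase the last digit of a word by one. -/
def plusWord : List ℕ → List ℕ
  | [] => []
  | [a] => [a + 1]
  | a :: b :: rest => a :: plusWord (b :: rest)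

/-- `w⁻`: decrease the last digit of a word by one. -/
def minusWord : List ℕ → List ℕ
  | [] => []
  | [a] => [a - 1]
  | a :: b :: rest => a :: minusWord (b :: rest)

/-- The reflection of a word: `\overline{w} = (M - w_1) ⋯ (M - w_k)`. -/
def reflWord (M : ℕ) (w : List ℕ) : List ℕ := w.map fun a => M - a

/-- The substitution `g(w) = w⁺ \overline{w⁺}`. -/
def gWord (M : ℕ) (w : List ℕ) : List ℕ := plusWord w ++ reflWord M (plusWord w)

/-- The periodic sequence `t^∞` determined by a word `t`. -/
def periodicSeq (t : List ℕ) (i : ℕ) : ℕ := t.getD (i % t.length) 0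

/-- Strict lexicographic order on words. -/
def wordLt (u v : List ℕ) : Prop := List.Lex (· < ·) u v

/-- Lexicographic order on words. -/
def wordLe (u v : List ℕ) : Prop := wordLt u v ∨ u = v

/-- The connected component `(q_0, q_0^*)` of `(q'(M), M+1) \ closure (U(M))` is
generated by the word `t`, and `θ = α(q_0^*)`: `α(q_0) = t^∞` and
`α(q_0^*) = lim_{n→∞} g^n(t)`, i.e. every `g^n(t)` is a prefix of `θ`. -/
def GeneratedBy (M : ℕ) (q₀ q₀star : ℝ) (t : List ℕ) (θ : ℕ → ℕ) : Prop :=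
  CC M q₀ q₀star ∧ t ≠ [] ∧ IsQuasiGreedy M q₀ (periodicSeq t) ∧
    IsQuasiGreedy M q₀star θ ∧
    ∀ n : ℕ, ∀ i < ((gWord M)^[n] t).length, ((gWord M)^[n] t).getD i 0 = θ i


lemma summable_digits {M : ℕ} {p : ℝ} (hp : 1 < p) {d : ℕ → ℕ} (hd : ∀ i, d i ≤ M) :
    Summable fun i : ℕ => (d i : ℝ) / p ^ (i + 1) := by
  have hg : Summable fun i : ℕ => (M : ℝ) * (p⁻¹) ^ (i + 1) :=
    ((summable_nat_add_iff 1).2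
      (summable_geometric_of_lt_one (by positivity) (inv_lt_one_of_one_lt₀ hp))).mul_left _
  refine Summable.of_nonneg_of_le (fun i => by positivity) (fun i => ?_) hg
  rw [inv_pow, ← div_eq_mul_inv]
  have : (d i : ℝ) ≤ M := by exact_mod_cast hd i
  gcongr

lemma piQ_nonneg {p : ℝ} (hp : 1 < p) (d : ℕ → ℕ) : 0 ≤ piQ p d :=
  tsum_nonneg fun i => by positivity

lemma piQ_split {M : ℕ} {p : ℝ} (hp : 1 < p) {d : ℕ → ℕ} (hd : ∀ i, d i ≤ M) (n : ℕ) :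
    piQ p d = ∑ i ∈ Finset.range n, (d i : ℝ) / p ^ (i + 1) + piQ p (fun i => d (n + i)) / p ^ n := by
  have h := (summable_digits hp hd).sum_add_tsum_nat_add n
  unfold piQ
  rw [← h, ← tsum_div_const]
  congr 2
  ext i
  rw [div_div, ← pow_add, add_comm i n]
  congr 2
  ring

lemma piQ_sub_of_agree {M : ℕ} {p : ℝ} (hp : 1 < p) {a b : ℕ → ℕ} (ha : ∀ i, a i ≤ M)
    (hb : ∀ i, b i ≤ M) {n : ℕ} (hab : ∀ i < n, a i = b i) :
    piQ p a - piQ p b = (piQ p (fun i => a (n + i)) - piQ p (fun i => b (n + i))) / p ^ n := by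
  rw [piQ_split hp ha n, piQ_split hp hb n,
    Finset.sum_congr rfl fun i hi => by rw [hab i (Finset.mem_range.1 hi)]]
  ring

lemma piQ_sub_of_first_diff {M : ℕ} {p : ℝ} (hp : 1 < p) {a b : ℕ → ℕ} (ha : ∀ i, a i ≤ M)
    (hb : ∀ i, b i ≤ M) {n : ℕ} (hab : ∀ i < n, a i = b i) :
    piQ p a - piQ p b = ((a n : ℝ) - b n + piQ p (fun i => a (n + 1 + i)) -
      piQ p (fun i => b (n + 1 + i))) / p ^ (n + 1) := by
  have hp0 : p ≠ 0 := by positivity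
  rw [piQ_split hp ha (n + 1), piQ_split hp hb (n + 1), Finset.sum_range_succ,
    Finset.sum_range_succ,
    Finset.sum_congr rfl fun i hi => by rw [hab i (Finset.mem_range.1 hi)]]
  field_simp
  ring

lemma piQ_step {M : ℕ} {p : ℝ} (hp : 1 < p) {d : ℕ → ℕ} (hd : ∀ i, d i ≤ M) (n : ℕ) :
    piQ p (fun i => d (n + 1 + i)) = p * piQ p (fun i => d (n + i)) - d n := by
  have h := piQ_split hp (d := fun i => d (n + i)) (fun i => hd _) 1
  have hp0 : p ≠ 0 := by positivity
  have e : (fun i => d (n + (1 + i))) = fun i => d (n + 1 + i) := by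
    ext i; rw [add_assoc]
  simp only [Finset.sum_range_one, add_zero, zero_add, pow_one, e] at h
  rw [h]
  field_simp
  ring

lemma piQ_const {p : ℝ} (hp : 1 < p) (M : ℕ) : piQ p (fun _ => M) = M / (p - 1) := by
  have h : piQ p (fun _ => M) = p * piQ p (fun _ => M) - M :=
    piQ_step (M := M) hp (d := fun _ => M) (fun _ => le_rfl) 0
  have : p - 1 ≠ 0 := by linarith
  rw [eq_div_iff this]
  linarith

lemma piQ_refl {M : ℕ} {p : ℝ} (hp : 1 < p) {d : ℕ → ℕ} (hd : ∀ i, d i ≤ M) :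
    piQ p (fun i => M - d i) = M / (p - 1) - piQ p d := by
  rw [← piQ_const hp M]
  unfold piQ
  rw [← (summable_digits hp fun _ : ℕ => le_refl M).tsum_sub (summable_digits hp hd)]
  congr 1
  ext i
  rw [Nat.cast_sub (hd i), sub_div]

lemma piQ_le {M : ℕ} {p : ℝ} (hp : 1 < p) {d : ℕ → ℕ} (hd : ∀ i, d i ≤ M) :
    piQ p d ≤ M / (p - 1) := by
  have := piQ_nonneg hp (fun i => M - d i)
  rw [piQ_refl hp hd] at this
  linarith

lemma exists_expansion {M : ℕ} {p : ℝ} (hp : 1 < p) (hpM : p ≤ M + 1) {x : ℝ}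
    (hx0 : 0 ≤ x) (hx1 : x ≤ M / (p - 1)) : ∃ e, IsExpansion M p x e := by
  let dig : ℝ → ℕ := fun y => min M ⌊p * y⌋₊
  let T : ℝ → ℝ := fun y => p * y - dig y
  have hT : ∀ y, 0 ≤ y ∧ y ≤ M / (p - 1) → 0 ≤ T y ∧ T y ≤ M / (p - 1) := by
    rintro y ⟨h0, h1⟩
    have hpy : 0 ≤ p * y := by positivity
    have hf := Nat.floor_le hpy
    have hf' := Nat.lt_floor_add_one (p * y)
    rw [le_div_iff₀ (by linarith)] at h1
    simp only [T, dig]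
    rcases le_total M ⌊p * y⌋₊ with h | h
    · rw [min_eq_left h]
      have : (M : ℝ) ≤ ⌊p * y⌋₊ := by exact_mod_cast h
      refine ⟨by linarith, ?_⟩
      rw [le_div_iff₀ (by linarith)]
      nlinarith
    · rw [min_eq_right h]
      refine ⟨by linarith, ?_⟩
      rw [le_div_iff₀ (by linarith)]
      nlinarith
  have hit : ∀ n, 0 ≤ T^[n] x ∧ T^[n] x ≤ M / (p - 1) := by
    intro n
    induction n with
    | zero => exact ⟨hx0, hx1⟩
    | succ n ih => rw [Function.iterate_succ_apply']; exact hT _ ih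
  let e : ℕ → ℕ := fun n => dig (T^[n] x)
  have he : ∀ i, e i ≤ M := fun i => min_le_left _ _
  have key : ∀ n, x - piQ p e = (T^[n] x - piQ p (fun i => e (n + i))) / p ^ n := by
    intro n
    induction n with
    | zero => simp
    | succ n ih =>
      rw [ih, piQ_step hp he, Function.iterate_succ_apply']
      have hp0 : p ≠ 0 := by positivity
      simp only [T, e]
      field_simp
      ring
  refine ⟨e, he, ?_⟩
  have hb : ∀ n, |x - piQ p e| ≤ M / (p - 1) * (p⁻¹) ^ n := by
    intro n
    rw [key n, abs_div, abs_of_pos (by positivity : 0 < p ^ n), inv_pow, ← div_eq_mul_inv]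
    gcongr
    rw [abs_le]
    have h1 := hit n
    have h2 := piQ_nonneg hp (fun i => e (n + i))
    have h3 := piQ_le hp (d := fun i => e (n + i)) (fun i => he _)
    constructor <;> linarith
  have hlim : Tendsto (fun n : ℕ => (M : ℝ) / (p - 1) * (p⁻¹) ^ n) atTop (nhds 0) := by
    have := (tendsto_pow_atTop_nhds_zero_of_lt_one (r := p⁻¹) (by positivity)
      (inv_lt_one_of_one_lt₀ hp)).const_mul ((M : ℝ) / (p - 1))
    simpa using this
  have := ge_of_tendsto' hlim hb
  have := abs_nonpos_iff.1 this
  linarith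

/-- Changing one digit of an expansion and re-expanding the remainder. -/
lemma exists_expansion_change {M : ℕ} {p : ℝ} (hp : 1 < p) (hpM : p ≤ M + 1) {d : ℕ → ℕ}
    (hd : ∀ i, d i ≤ M) (n v : ℕ) (hv : v ≤ M)
    (h0 : 0 ≤ (d n : ℝ) + piQ p (fun i => d (n + 1 + i)) - v)
    (h1 : (d n : ℝ) + piQ p (fun i => d (n + 1 + i)) - v ≤ M / (p - 1)) :
    ∃ e, IsExpansion M p (piQ p d) e ∧ e n = v := by
  obtain ⟨f, hf, hfx⟩ := exists_expansion hp hpM h0 h1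
  let e : ℕ → ℕ := fun i => if i < n then d i else if i = n then v else f (i - (n + 1))
  have he : ∀ i, e i ≤ M := by
    intro i
    simp only [e]
    split_ifs
    exacts [hd i, hv, hf _]
  have hen : e n = v := by simp [e]
  refine ⟨e, ⟨he, ?_⟩, hen⟩
  have h := piQ_sub_of_first_diff hp he hd (n := n) (fun i hi => by simp [e, hi])
  have ht : (fun i => e (n + 1 + i)) = f := by
    ext i
    have h1 : ¬ n + 1 + i < n := by omega
    have h2 : ¬ n + 1 + i = n := by omega
    have h3 : n + 1 + i - (n + 1) = i := by omega
    simp only [e, h1, h2, h3, if_false]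
  rw [ht, hen, hfx] at h
  have : ((v : ℝ) - d n + ((d n : ℝ) + piQ p (fun i => d (n + 1 + i)) - v) -
      piQ p (fun i => d (n + 1 + i))) = 0 := by ring
  rw [this, zero_div] at h
  linarith

/-- The tails of the unique expansion of `1`, and their reflections, have value below `1`. -/
lemma tails_lt_one {M : ℕ} {q : ℝ} (hq : 1 < q) (hqM : q < M + 1) {a : ℕ → ℕ}
    (ha : IsExpansion M q 1 a) (hu : ∀ e, IsExpansion M q 1 e → e = a) :
    (∀ n, piQ q (fun i => a (n + 1 + i)) < 1) ∧
      ∀ n, M / (q - 1) - piQ q (fun i => a (n + i)) < 1 := by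
  obtain ⟨hd, h1⟩ := ha
  have hx : ∀ n, piQ q (fun i => a (n + 1 + i)) < 1 := by
    intro n
    by_contra! hcon
    by_cases hn : a n < M
    · obtain ⟨e, he, hen⟩ := exists_expansion_change hq hqM.le hd n (a n + 1) hn
        (by push_cast; linarith)
        (by push_cast; linarith [piQ_le hq (d := fun i => a (n + 1 + i)) (fun i => hd _)])
      rw [h1] at he
      rw [hu e he] at hen
      omega
    · have hnM : a n = M := le_antisymm (hd n) (not_lt.1 hn)
      have key : ∀ k, piQ q (fun i => a (k + i)) ≤ 1 := by
        intro k
        induction k with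
        | zero => simp [h1]
        | succ k ih =>
          by_contra! hc
          by_cases hk : a k < M
          · obtain ⟨e, he, hen⟩ := exists_expansion_change hq hqM.le hd k (a k + 1) hk
              (by push_cast; linarith)
              (by push_cast; linarith [piQ_le hq (d := fun i => a (k + 1 + i)) (fun i => hd _)])
            rw [h1] at he
            rw [hu e he] at hen
            omega
          · have hkM : a k = M := le_antisymm (hd k) (not_lt.1 hk)
            rw [piQ_step hq hd, hkM] at hc
            nlinarith
      have := key n
      rw [piQ_step hq hd, hnM] at hcon
      nlinarith
  have ha0 : 0 < a 0 := by
    have h := hx 0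
    rw [piQ_step hq hd] at h
    simp only [zero_add, h1] at h
    have : (0 : ℝ) < a 0 := by linarith
    exact_mod_cast this
  have hy : ∀ n, M / (q - 1) - piQ q (fun i => a (n + 1 + i)) < 1 := by
    have pos : ∀ n, 0 < a n → M / (q - 1) - piQ q (fun i => a (n + 1 + i)) < 1 := by
      intro n hn
      by_contra! hcon
      obtain ⟨e, he, hen⟩ := exists_expansion_change hq hqM.le hd n (a n - 1)
        ((Nat.sub_le _ _).trans (hd n))
        (by push_cast [Nat.cast_sub hn]; linarith [piQ_nonneg hq (fun i => a (n + 1 + i))])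
        (by push_cast [Nat.cast_sub hn]; linarith)
      rw [h1] at he
      rw [hu e he] at hen
      omega
    intro n
    induction n with
    | zero => exact pos 0 ha0
    | succ n ih =>
      rcases Nat.eq_zero_or_pos (a (n + 1)) with h | h
      · rw [piQ_step hq hd, h]
        have : (M : ℝ) / (q - 1) * (q - 1) = M := div_mul_cancel₀ _ (by linarith)
        push_cast
        nlinarith
      · exact pos _ h
  refine ⟨hx, fun n => ?_⟩
  rcases n with _ | n
  · have := hx 0
    have := hy 0
    simp only [zero_add, h1] at *
    linarith
  · exact hy n

lemma seqLt_trichotomy (a b : ℕ → ℕ) : a = b ∨ seqLt a b ∨ seqLt b a := by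
  classical
  by_cases h : a = b
  · exact Or.inl h
  · right
    have hne : ∃ n, a n ≠ b n := Function.ne_iff.1 h
    have hmin : ∀ i < Nat.find hne, a i = b i := fun i hi => not_not.1 (Nat.find_min hne hi)
    rcases lt_or_gt_of_ne (Nat.find_spec hne) with h' | h'
    · exact Or.inl ⟨_, hmin, h'⟩
    · exact Or.inr ⟨_, fun i hi => (hmin i hi).symm, h'⟩

lemma piQ_lt_of_seqLt {M : ℕ} {q : ℝ} (hq : 1 < q) {a d : ℕ → ℕ} (ha : ∀ i, a i ≤ M)
    (hd : ∀ i, d i ≤ M) (hx : ∀ n, piQ q (fun i => a (n + 1 + i)) < 1) (h : seqLt a d) :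
    piQ q a < piQ q d := by
  obtain ⟨n, hn, hlt⟩ := h
  have h := piQ_sub_of_first_diff hq ha hd hn
  have h1 : (a n : ℝ) + 1 ≤ d n := by exact_mod_cast hlt
  have : (a n : ℝ) - d n + piQ q (fun i => a (n + 1 + i)) - piQ q (fun i => d (n + 1 + i)) < 0 := by
    linarith [hx n, piQ_nonneg hq (fun i => d (n + 1 + i))]
  have := div_neg_of_neg_of_pos this (by positivity : 0 < q ^ (n + 1))
  linarith

lemma seqLt_of_piQ_lt {M : ℕ} {q : ℝ} (hq : 1 < q) {a d : ℕ → ℕ} (ha : ∀ i, a i ≤ M)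
    (hd : ∀ i, d i ≤ M) (hx : ∀ n, piQ q (fun i => a (n + 1 + i)) < 1)
    (h : piQ q d < piQ q a) : seqLt d a := by
  rcases seqLt_trichotomy d a with h' | h' | h'
  · rw [h'] at h; exact absurd h (lt_irrefl _)
  · exact h'
  · exact absurd (piQ_lt_of_seqLt hq ha hd hx h') (not_lt.2 h.le)

/-- Lexicographic conditions characterising the unique expansion of `1` in a univoque base below `M + 1`. -/
structure LexUnivoque (M : ℕ) (a : ℕ → ℕ) : Prop where
  le : ∀ i, a i ≤ M
  lt : ∀ n, seqLt (fun i => a (n + 1 + i)) a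
  refl_lt : ∀ n, seqLt (fun i => M - a (n + i)) a

lemma lexUnivoque_of_unique {M : ℕ} {q : ℝ} (hq : 1 < q) (hqM : q < M + 1) {a : ℕ → ℕ}
    (ha : IsExpansion M q 1 a) (hu : ∀ e, IsExpansion M q 1 e → e = a) : LexUnivoque M a := by
  obtain ⟨hx, hy⟩ := tails_lt_one hq hqM ha hu
  refine ⟨ha.1, fun n => ?_, fun n => ?_⟩
  · exact seqLt_of_piQ_lt hq ha.1 (fun i => ha.1 _) hx (by rw [ha.2]; exact hx n)
  · refine seqLt_of_piQ_lt hq ha.1 (fun i => Nat.sub_le _ _) hx ?_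
    rw [ha.2, piQ_refl hq (d := fun i => a (n + i)) fun i => ha.1 _]
    exact hy n

/-- If every tail of `d` is below `c`, and `c` is an expansion of `1`, the tails of `d` have value
below `1`. -/
lemma piQ_tail_lt_one {M : ℕ} {p : ℝ} (hp : 1 < p) {c d : ℕ → ℕ} (hc : IsExpansion M p 1 c)
    (hd : ∀ i, d i ≤ M) (hlt : ∀ n, seqLt (fun i => d (n + i)) c)
    (hpos : ∀ n, 0 < piQ p (fun i => c (n + i))) (n : ℕ) : piQ p (fun i => d (n + i)) < 1 := by
  obtain ⟨hcM, hc1⟩ := hc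
  have first : ∀ n, ∃ j, piQ p (fun i => d (n + i)) - 1 ≤
      (piQ p (fun i => d (n + (j + 1) + i)) - 1 - piQ p (fun i => c (j + 1 + i))) / p ^ (j + 1) := by
    intro n
    obtain ⟨j, hj, hjlt⟩ := hlt n
    refine ⟨j, ?_⟩
    have h := piQ_sub_of_first_diff hp (a := fun i => d (n + i)) (fun i => hd _) hcM hj
    rw [hc1] at h
    rw [h]
    have h1 : (d (n + j) : ℝ) + 1 ≤ c j := by exact_mod_cast hjlt
    have e : (fun i => d (n + (j + 1 + i))) = fun i => d (n + (j + 1) + i) := by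
      ext i; rw [add_assoc n]
    simp only [e]
    gcongr
    linarith
  have bound : ∀ k n, piQ p (fun i => d (n + i)) - 1 ≤ M / (p - 1) * (p⁻¹) ^ k := by
    intro k
    induction k with
    | zero =>
      intro n
      have := piQ_le hp (d := fun i => d (n + i)) fun i => hd _
      simp only [pow_zero, mul_one]
      linarith
    | succ k ih =>
      intro n
      obtain ⟨j, hj⟩ := first n
      refine hj.trans ?_
      have hB : 0 ≤ (M : ℝ) / (p - 1) := div_nonneg (by positivity) (by linarith)
      have hX : 0 ≤ (M : ℝ) / (p - 1) * (p⁻¹) ^ k := by positivity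
      rw [div_le_iff₀ (by positivity)]
      have h1 := ih (n + (j + 1))
      have h2 := hpos (j + 1)
      have hpj : p ≤ p ^ (j + 1) := le_self_pow₀ hp.le (by omega)
      calc _ ≤ (M : ℝ) / (p - 1) * (p⁻¹) ^ k := by linarith
        _ = (M : ℝ) / (p - 1) * (p⁻¹) ^ (k + 1) * p := by
          rw [pow_succ]; field_simp
        _ ≤ _ := by gcongr
  have hle : ∀ n, piQ p (fun i => d (n + i)) ≤ 1 := by
    intro n
    have hlim : Tendsto (fun k : ℕ => (M : ℝ) / (p - 1) * (p⁻¹) ^ k) atTop (nhds 0) := by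
      have := (tendsto_pow_atTop_nhds_zero_of_lt_one (r := p⁻¹) (by positivity)
        (inv_lt_one_of_one_lt₀ hp)).const_mul ((M : ℝ) / (p - 1))
      simpa using this
    have := ge_of_tendsto' hlim fun k => bound k n
    linarith
  obtain ⟨j, hj⟩ := first n
  have h1 := hle (n + (j + 1))
  have h2 := hpos (j + 1)
  have := div_neg_of_neg_of_pos
    (by linarith : piQ p (fun i => d (n + (j + 1) + i)) - 1 - piQ p (fun i => c (j + 1 + i)) < 0)
    (by positivity : 0 < p ^ (j + 1))
  linarith

lemma piQ_ge_of_digit {M : ℕ} {p : ℝ} (hp : 1 < p) {d : ℕ → ℕ} (hd : ∀ i, d i ≤ M) {k : ℕ}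
    (hk : 0 < d k) : 1 / p ^ (k + 1) ≤ piQ p d := by
  have h := (summable_digits hp hd).le_tsum k (fun j _ => by positivity)
  refine le_trans ?_ h
  have : (1 : ℝ) ≤ d k := by exact_mod_cast hk
  gcongr

lemma LexUnivoque.exists_pos {M : ℕ} {c : ℕ → ℕ} (hc : LexUnivoque M c) {m : ℕ} (hm : c m < M)
    (n : ℕ) : ∃ k ≤ m, 0 < c (n + k) := by
  by_contra! h
  obtain ⟨j, hj, hlt⟩ := hc.refl_lt n
  have h0 : ∀ k ≤ m, c (n + k) = 0 := fun k hk => Nat.le_zero.1 (h k hk)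
  have hle := hc.le
  rcases le_or_gt j m with hjm | hjm
  · simp only [h0 j hjm] at hlt
    have := hle j
    omega
  · have h1 := hj m hjm
    simp only [h0 m le_rfl] at h1
    omega

/-- The tail values of a lexicographically univoque expansion of `1`. -/
lemma LexUnivoque.tails {M : ℕ} {p : ℝ} (hp : 1 < p) {c : ℕ → ℕ} (hc : LexUnivoque M c) {m : ℕ}
    (hm : c m < M) (h1 : piQ p c = 1) :
    (∀ n, piQ p (fun i => c (n + 1 + i)) < 1) ∧
      ∀ n, M / (p - 1) - piQ p (fun i => c (n + i)) < 1 := by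
  have hpos : ∀ n, 0 < piQ p (fun i => c (n + i)) := by
    intro n
    obtain ⟨k, -, hk⟩ := hc.exists_pos hm n
    exact lt_of_lt_of_le (by positivity)
      (piQ_ge_of_digit hp (d := fun i => c (n + i)) (fun i => hc.le _) hk)
  constructor
  · intro n
    have := piQ_tail_lt_one hp ⟨hc.le, h1⟩ (d := fun i => c (1 + i)) (fun i => hc.le _)
      (fun n => by
        have := hc.lt n
        have e : (fun i => c (1 + (n + i))) = fun i => c (n + 1 + i) := by
          ext i; congr 1; ring
        rwa [e]) hpos n
    have e : (fun i => c (1 + (n + i))) = fun i => c (n + 1 + i) := by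
      ext i; congr 1; ring
    rwa [e] at this
  · intro n
    rw [← piQ_refl hp (d := fun i => c (n + i)) fun i => hc.le _]
    exact piQ_tail_lt_one hp ⟨hc.le, h1⟩ (d := fun i => M - c i) (fun i => Nat.sub_le _ _)
      hc.refl_lt hpos n

lemma LexUnivoque.mem_univBases {M : ℕ} {p : ℝ} (hp : 1 < p) (hpM : p ≤ M + 1) {c : ℕ → ℕ}
    (hc : LexUnivoque M c) {m : ℕ} (hm : c m < M) (h1 : piQ p c = 1) : p ∈ UnivBases M := by
  obtain ⟨hx, hy⟩ := hc.tails hp hm h1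
  refine ⟨hp, hpM, c, ⟨hc.le, h1⟩, ?_⟩
  rintro e ⟨heM, he1⟩
  rcases seqLt_trichotomy e c with h | h | h
  · exact h
  · exfalso
    obtain ⟨n, hn, hlt⟩ := h
    have h := piQ_sub_of_first_diff hp heM hc.le hn
    rw [he1, h1, sub_self, eq_comm, div_eq_zero_iff] at h
    have h2 := h.resolve_right (by positivity)
    have h3 : (e n : ℝ) + 1 ≤ c n := by exact_mod_cast hlt
    have := hy (n + 1)
    have := piQ_le hp (d := fun i => e (n + 1 + i)) fun i => heM _
    linarith
  · exact absurd (piQ_lt_of_seqLt hp hc.le heM hx h) (by rw [h1, he1]; exact lt_irrefl _)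

/-- Separation: the values in base `p` of two lexicographically univoque sequences first differing
at `j`, the smaller one expanding `1`. -/
lemma LexUnivoque.piQ_gap {M : ℕ} {p : ℝ} (hp : 1 < p) {c c' : ℕ → ℕ}
    (hc : LexUnivoque M c) (hc' : LexUnivoque M c') {m : ℕ} (hm : c m < M) (hm' : c' m < M)
    (h1 : piQ p c = 1) {j : ℕ} (hj : ∀ i < j, c i = c' i) (hlt : c j < c' j) :
    1 / p ^ (j + m + 2) ≤ piQ p c' - 1 := by
  obtain ⟨hx, -⟩ := hc.tails hp hm h1
  have h := piQ_sub_of_first_diff hp hc.le hc'.le hj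
  obtain ⟨k, hkm, hk⟩ := hc'.exists_pos hm' (j + 1)
  have hg := piQ_ge_of_digit hp (d := fun i => c' (j + 1 + i)) (fun i => hc'.le _) hk
  have h3 : (c j : ℝ) + 1 ≤ c' j := by exact_mod_cast hlt
  have h4 := hx j
  have h5 : 1 / p ^ (m + 1) ≤ 1 / p ^ (k + 1) := by
    gcongr
    exact hp.le
  have h6 : piQ p c' - 1 = ((c' j : ℝ) - c j + piQ p (fun i => c' (j + 1 + i)) -
      piQ p (fun i => c (j + 1 + i))) / p ^ (j + 1) := by
    rw [h1] at h
    rw [← neg_inj, neg_sub, h]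
    ring
  rw [h6, show j + m + 2 = (m + 1) + (j + 1) by ring, pow_add, ← div_div]
  gcongr
  linarith

/-- Prefix lengths `m` at which every proper suffix of the prefix is strictly below the
corresponding prefix. -/
def IsStrictPrefix (a : ℕ → ℕ) (m : ℕ) : Prop :=
  ∀ k, 1 ≤ k → k < m → ∃ j, k + j < m ∧ (∀ l < j, a (k + l) = a l) ∧ a (k + j) < a j

lemma LexUnivoque.exists_strictPrefix {M : ℕ} {a : ℕ → ℕ} (ha : LexUnivoque M a) (N : ℕ) :
    ∃ m, N + 1 < m ∧ a (m - 1) < M ∧ IsStrictPrefix a m := by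
  have hlt : ∀ i, ∃ j, 1 ≤ i → (∀ l < j, a (i + l) = a l) ∧ a (i + j) < a j := by
    intro i
    rcases i with _ | i
    · exact ⟨0, fun h => by omega⟩
    · obtain ⟨j, hj⟩ := ha.lt i
      exact ⟨j, fun _ => hj⟩
  choose J hJ using hlt
  obtain ⟨i, hi, hmax⟩ := Finset.exists_max_image (Finset.Icc 1 (N + 1)) (fun i => i + J i)
    ⟨1, by simp⟩
  rw [Finset.mem_Icc] at hi
  have hN : N + 1 ≤ i + J i :=
    le_trans (Nat.le_add_right _ _) (hmax (N + 1) (Finset.mem_Icc.2 ⟨by omega, le_rfl⟩))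
  obtain ⟨hieq, hilt⟩ := hJ i hi.1
  refine ⟨i + J i + 1, by omega, ?_, ?_⟩
  · simp only [Nat.add_sub_cancel]
    exact hilt.trans_le (ha.le _)
  · intro k hk1 hkm
    by_cases hkN : k ≤ N + 1
    · have := hmax k (Finset.mem_Icc.2 ⟨hk1, hkN⟩)
      exact ⟨J k, Nat.lt_succ_of_le this, hJ k hk1⟩
    · obtain ⟨d, rfl⟩ : ∃ d, k = i + d := ⟨k - i, by omega⟩
      obtain ⟨hdeq, hdlt⟩ := hJ d (by omega)
      by_cases hcmp : d + J d < J i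
      · refine ⟨J d, by omega, fun l hl => ?_, ?_⟩
        · rw [add_assoc, hieq _ (by omega), hdeq l hl]
        · rw [add_assoc, hieq _ hcmp]
          exact hdlt
      · obtain ⟨l, hl⟩ : ∃ l, J i = d + l := ⟨J i - d, by omega⟩
        refine ⟨l, by omega, fun l' hl' => ?_, ?_⟩
        · rw [add_assoc, hieq _ (by omega), hdeq l' (by omega)]
        · rw [add_assoc, ← hl]
          refine hilt.trans_le ?_
          rw [hl]
          rcases Nat.lt_or_ge l (J d) with h | h
          · exact (hdeq l h).le
          · rw [show l = J d by omega]
            exact hdlt.le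

/-- The sequence obtained from the word `w = a_0 ⋯ a_{m-1}` and a bit sequence `t`: the block with
index `i` is `w`, with last digit increased by one if `t i ≠ t (i + 1)`, reflected if `t i`. -/
def tune (M m : ℕ) (a : ℕ → ℕ) (t : ℕ → Bool) (n : ℕ) : ℕ :=
  if t (n / m) then M - (a (n % m) + if n % m + 1 = m ∧ t (n / m) ≠ t (n / m + 1) then 1 else 0)
  else a (n % m) + if n % m + 1 = m ∧ t (n / m) ≠ t (n / m + 1) then 1 else 0

lemma tune_block {M m : ℕ} (a : ℕ → ℕ) (t : ℕ → Bool) (i : ℕ) {k : ℕ} (hk : k < m) :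
    tune M m a t (i * m + k) =
      if t i then M - (a k + if k + 1 = m ∧ t i ≠ t (i + 1) then 1 else 0)
      else a k + if k + 1 = m ∧ t i ≠ t (i + 1) then 1 else 0 := by
  have h1 : (i * m + k) / m = i := by
    rw [mul_comm, Nat.mul_add_div (by omega), Nat.div_eq_of_lt hk, add_zero]
  have h2 : (i * m + k) % m = k := by
    rw [mul_comm, Nat.mul_add_mod, Nat.mod_eq_of_lt hk]
  simp only [tune, h1, h2]

lemma tune_zero {M m : ℕ} (a : ℕ → ℕ) (t : ℕ → Bool) {k : ℕ} (hk : k < m) :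
    tune M m a t k =
      if t 0 then M - (a k + if k + 1 = m ∧ t 0 ≠ t 1 then 1 else 0)
      else a k + if k + 1 = m ∧ t 0 ≠ t 1 then 1 else 0 := by
  simpa using tune_block (M := M) a t 0 hk

lemma tune_shift {M m : ℕ} (hm : 0 < m) (a : ℕ → ℕ) (t : ℕ → Bool) (i n : ℕ) :
    tune M m a t (i * m + n) = tune M m a (fun l => t (i + l)) n := by
  have h1 : (i * m + n) / m = i + n / m := by
    rw [mul_comm, Nat.mul_add_div hm]
  have h2 : (i * m + n) % m = n % m := by
    rw [mul_comm, Nat.mul_add_mod]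
  simp only [tune, h1, h2, add_assoc]

lemma digit_add_le {M m : ℕ} {a : ℕ → ℕ} (ha : ∀ i, a i ≤ M) (hlast : a (m - 1) < M) (k : ℕ)
    (P : Prop) [Decidable P] : a k + (if k + 1 = m ∧ P then 1 else 0) ≤ M := by
  split_ifs with h
  · rw [show k = m - 1 by omega]
    exact hlast
  · exact ha k

lemma tune_le {M m : ℕ} {a : ℕ → ℕ} (ha : ∀ i, a i ≤ M) (hlast : a (m - 1) < M)
    (t : ℕ → Bool) (n : ℕ) : tune M m a t n ≤ M := by
  unfold tune
  have := digit_add_le ha hlast (n % m) (t (n / m) ≠ t (n / m + 1))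
  split <;> omega

lemma tune_not {M m : ℕ} {a : ℕ → ℕ} (ha : ∀ i, a i ≤ M) (hlast : a (m - 1) < M)
    (t : ℕ → Bool) (n : ℕ) : tune M m a (fun i => !t i) n = M - tune M m a t n := by
  have h := digit_add_le ha hlast (n % m) (t (n / m) ≠ t (n / m + 1))
  have hb : ((!t (n / m)) ≠ !t (n / m + 1)) ↔ (t (n / m) ≠ t (n / m + 1)) := by simp
  unfold tune
  simp only [hb]
  cases ht : t (n / m)
  · simp
  · simp only [ht] at h
    simp only [Bool.not_true, Bool.false_eq_true, if_false, if_true]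
    omega

/-- At the first change of bits the tuned sequences differ for the first time, in the same
direction. -/
lemma tune_first_diff {M m : ℕ} (hm : 0 < m) {a : ℕ → ℕ}
    (hlast : a (m - 1) < M) {s t : ℕ → Bool} {i : ℕ} (hst : ∀ l ≤ i, t l = s l)
    (ht : t (i + 1) = false) (hs : s (i + 1) = true) :
    (∀ n < i * m + (m - 1), tune M m a t n = tune M m a s n) ∧
      tune M m a t (i * m + (m - 1)) < tune M m a s (i * m + (m - 1)) := by
  constructor
  · intro n hn
    have hdm := Nat.div_add_mod n m
    have hmod := Nat.mod_lt n hm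
    rcases Nat.lt_trichotomy (n / m) i with h | h | h
    · simp only [tune, hst (n / m) h.le, hst (n / m + 1) h]
    · have : ¬ (n % m + 1 = m) := by
        intro hc
        rw [h, mul_comm m i] at hdm
        omega
      simp only [tune, this, hst (n / m) h.le, false_and]
    · exfalso
      have : m * (i + 1) ≤ m * (n / m) := Nat.mul_le_mul_left m h
      rw [mul_add, mul_comm m i] at this
      omega
  · rw [tune_block a t i (by omega), tune_block a s i (by omega), hst i le_rfl, ht, hs]
    have : m - 1 + 1 = m := by omega
    cases s i <;> simp [this]; omega

lemma tune_tail_lt {M m : ℕ} {a : ℕ → ℕ} (ha : LexUnivoque M a) (hlast : a (m - 1) < M)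
    (hpre : IsStrictPrefix a m) {s t : ℕ → Bool} (hs0 : s 0 = false) (hs1 : s 1 = true)
    {k : ℕ} (hk1 : 1 ≤ k) (hkm : k < m) :
    seqLt (fun i => tune M m a t (k + i)) (tune M m a s) := by
  have haM := ha.le
  have hc : ∀ l < m - 1, tune M m a s l = a l := by
    intro l hl
    rw [tune_zero a s (by omega), hs0]
    simp [show ¬ l + 1 = m by omega]
  have hclast : tune M m a s (m - 1) = a (m - 1) + 1 := by
    rw [tune_zero a s (by omega), hs0, hs1]
    simp [show m - 1 + 1 = m by omega]
  have finish : t 1 = true → (∀ l < m - k, tune M m a t (k + l) = a l) →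
      seqLt (fun i => tune M m a t (k + i)) (tune M m a s) := by
    intro ht1 hag
    have hnext : ∀ l < m - 1, tune M m a t (k + (m - k + l)) = M - a l := by
      intro l hl
      rw [show k + (m - k + l) = 1 * m + l by omega, tune_block a t 1 (by omega), ht1]
      simp [show ¬ l + 1 = m by omega]
    obtain ⟨j, hj, hjlt⟩ := ha.refl_lt (m - k)
    simp only at hjlt
    rcases Nat.lt_or_ge j (k - 1) with h | h
    · refine ⟨m - k + j, fun i hi => ?_, ?_⟩
      · rcases Nat.lt_or_ge i (m - k) with h' | h'
        · simp only [hag i h', hc i (by omega)]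
        · obtain ⟨l, rfl⟩ := Nat.exists_eq_add_of_le h'
          have h1 : M - a (m - k + l) = a l := hj l (by omega)
          simp only [hnext l (by omega), hc (m - k + l) (by omega)]
          have := haM (m - k + l)
          omega
      · simp only [hnext j (by omega), hc (m - k + j) (by omega)]
        have := haM (m - k + j)
        have := haM j
        omega
    · refine ⟨m - 1, fun i hi => ?_, ?_⟩
      · rcases Nat.lt_or_ge i (m - k) with h' | h'
        · simp only [hag i h', hc i (by omega)]
        · obtain ⟨l, rfl⟩ := Nat.exists_eq_add_of_le h'
          have h1 : M - a (m - k + l) = a l := hj l (by omega)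
          simp only [hnext l (by omega), hc (m - k + l) (by omega)]
          have := haM (m - k + l)
          omega
      · have h1 := hnext (k - 1) (by omega)
        have e : m - k + (k - 1) = m - 1 := by omega
        rw [e] at h1
        simp only [h1, hclast]
        have h2 := haM (m - 1)
        rcases Nat.lt_or_ge (k - 1) j with h' | h'
        · have := hj (k - 1) h'
          simp only [e] at this
          omega
        · have e' : j = k - 1 := by omega
          rw [e', e] at hjlt
          omega
  have htl : ∀ l, k + l < m → tune M m a t (k + l) =
      if t 0 then M - (a (k + l) + if k + l + 1 = m ∧ t 0 ≠ t 1 then 1 else 0)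
      else a (k + l) + if k + l + 1 = m ∧ t 0 ≠ t 1 then 1 else 0 :=
    fun l hl => tune_zero a t hl
  cases ht0 : t 0
  · simp only [ht0, Bool.false_eq_true, if_false] at htl
    obtain ⟨j, hjm, hj, hjlt⟩ := hpre k hk1 hkm
    have hag : ∀ l < j, tune M m a t (k + l) = a l := by
      intro l hl
      rw [htl l (by omega), ← hj l hl]
      simp [show ¬ k + l + 1 = m by omega]
    by_cases hlt : tune M m a t (k + j) < a j
    · exact ⟨j, fun i hi => by rw [hc i (by omega)]; exact hag i hi,
        by rw [hc j (by omega)]; exact hlt⟩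
    · have hv := htl j hjm
      by_cases hP : k + j + 1 = m ∧ false ≠ t 1
      · rw [if_pos hP] at hv
        refine finish (by simpa using hP.2) fun l hl => ?_
        rcases Nat.lt_or_ge l j with h | h
        · exact hag l h
        · rw [show l = j by omega]
          omega
      · rw [if_neg hP] at hv
        omega
  · simp only [ht0, if_true] at htl
    obtain ⟨j, hj, hjlt⟩ := ha.refl_lt k
    simp only at hjlt
    have hag : ∀ l < j, k + l + 1 < m → tune M m a t (k + l) = a l := by
      intro l hl hm'
      rw [htl l (by omega), ← hj l hl]
      simp [show ¬ k + l + 1 = m by omega]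
    by_cases hjm : k + j < m
    · refine ⟨j, fun i hi => by rw [hc i (by omega)]; exact hag i hi (by omega), ?_⟩
      simp only [hc j (by omega), htl j hjm]
      omega
    · have hlastv := htl (m - 1 - k) (by omega)
      have h1 := hj (m - 1 - k) (by omega)
      have e : k + (m - 1 - k) = m - 1 := by omega
      simp only [e, show m - 1 + 1 = m by omega] at hlastv h1
      cases ht1 : t 1
      · refine ⟨m - 1 - k, fun i hi => by rw [hc i (by omega)]; exact hag i (by omega) (by omega),
          ?_⟩
        simp only [hc (m - 1 - k) (by omega), e, hlastv, ht1]
        simp only [true_and, ne_eq, Bool.true_eq_false, not_false_eq_true, if_true]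
        omega
      · refine finish ht1 fun l hl => ?_
        rcases Nat.lt_or_ge l (m - 1 - k) with h | h
        · exact hag l (by omega) (by omega)
        · rw [show l = m - 1 - k by omega, e, hlastv, ht1]
          simpa using h1

/-- A tuned sequence is below the one starting with bits `0111` unless its bits do the same. -/
lemma tune_lt {M m : ℕ} (hm : 0 < m) {a : ℕ → ℕ} (ha : LexUnivoque M a) (hlast : a (m - 1) < M)
    {s t : ℕ → Bool} (hs0 : s 0 = false) (hs : ∀ i, 1 ≤ i → i ≤ 3 → s i = true)
    (ht : t 0 = false → ∃ i, 1 ≤ i ∧ i ≤ 3 ∧ t i = false) :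
    seqLt (tune M m a t) (tune M m a s) := by
  have hs1 := hs 1 le_rfl (by omega)
  cases ht0 : t 0
  · have hex : ∃ i, t (i + 1) = false ∧ i ≤ 2 := by
      obtain ⟨i, h1, h3, hi⟩ := ht ht0
      exact ⟨i - 1, by rwa [show i - 1 + 1 = i by omega], by omega⟩
    classical
    have hspec := Nat.find_spec hex
    have hmin : ∀ l < Nat.find hex, t (l + 1) = true := fun l hl => by
      have := Nat.find_min hex hl
      by_contra hc
      exact this ⟨by simpa using hc, by omega⟩
    obtain ⟨h1, h2⟩ := tune_first_diff (M := M) hm (a := a) hlast (s := s) (t := t)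
      (i := Nat.find hex) (fun l hl => by
        rcases l with _ | l
        · rw [ht0, hs0]
        · rw [hmin l hl, hs (l + 1) (by omega) (by omega)]) hspec.1
      (hs _ (by omega) (by omega))
    exact ⟨_, h1, h2⟩
  · have hc : ∀ l < m - 1, tune M m a s l = a l := by
      intro l hl
      rw [tune_zero a s (by omega), hs0]
      simp [show ¬ l + 1 = m by omega]
    have hclast : tune M m a s (m - 1) = a (m - 1) + 1 := by
      rw [tune_zero a s (by omega), hs0, hs1]
      simp [show m - 1 + 1 = m by omega]
    have htl : ∀ l < m - 1, tune M m a t l = M - a l := by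
      intro l hl
      rw [tune_zero a t (by omega), ht0]
      simp [show ¬ l + 1 = m by omega]
    have htlast : tune M m a t (m - 1) ≤ M - a (m - 1) := by
      rw [tune_zero a t (by omega), ht0, if_pos rfl]
      omega
    obtain ⟨j, hj, hjlt⟩ := ha.refl_lt 0
    simp only [zero_add] at hj hjlt
    rcases Nat.lt_or_ge j (m - 1) with h | h
    · refine ⟨j, fun i hi => ?_, ?_⟩
      · rw [hc i (by omega), htl i (by omega), hj i hi]
      · rwa [hc j h, htl j h]
    · refine ⟨m - 1, fun i hi => ?_, ?_⟩
      · rw [hc i hi, htl i hi, hj i (by omega)]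
      · rw [hclast]
        rcases Nat.lt_or_ge (m - 1) j with h' | h'
        · have := hj _ h'
          omega
        · rw [show j = m - 1 by omega] at hjlt
          omega

/-- The bit sequence `0111` followed by the pairs `y_k, 1 - y_k`. -/
def pairBits (y : ℕ → Bool) (n : ℕ) : Bool :=
  if n = 0 then false else if n < 4 then true
  else if n % 2 = 0 then y ((n - 4) / 2) else !y ((n - 4) / 2)

lemma pairBits_zero (y : ℕ → Bool) : pairBits y 0 = false := rfl

lemma pairBits_one_to_three (y : ℕ → Bool) (i : ℕ) (h1 : 1 ≤ i) (h3 : i ≤ 3) :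
    pairBits y i = true := by
  simp [pairBits, show i ≠ 0 by omega, show i < 4 by omega]

lemma pairBits_even (y : ℕ → Bool) (k : ℕ) : pairBits y (4 + 2 * k) = y k := by
  simp [pairBits, show (4 + 2 * k) % 2 = 0 by omega]

lemma pairBits_odd (y : ℕ → Bool) (k : ℕ) : pairBits y (4 + 2 * k + 1) = !y k := by
  rw [pairBits, if_neg (by omega), if_neg (by omega), if_neg (by omega),
    show (4 + 2 * k + 1 - 4) / 2 = k by omega]

/-- Three consecutive bits of index at least `4` take both values. -/
lemma exists_pairBits (y : ℕ → Bool) (b : Bool) {i : ℕ} (hi : 3 ≤ i) :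
    ∃ j, 1 ≤ j ∧ j ≤ 3 ∧ pairBits y (i + j) = b := by
  obtain ⟨k, hk1, hk2⟩ : ∃ k, i + 1 ≤ 4 + 2 * k ∧ 4 + 2 * k + 1 ≤ i + 3 :=
    ⟨(i - 2) / 2, by omega, by omega⟩
  by_cases h : y k = b
  · exact ⟨4 + 2 * k - i, by omega, by omega, by
      rw [show i + (4 + 2 * k - i) = 4 + 2 * k by omega, pairBits_even, h]⟩
  · exact ⟨4 + 2 * k + 1 - i, by omega, by omega, by
      rw [show i + (4 + 2 * k + 1 - i) = 4 + 2 * k + 1 by omega, pairBits_odd]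
      cases hy : y k <;> cases b <;> simp_all⟩

lemma lexUnivoque_tune {M m : ℕ} (hm : 0 < m) {a : ℕ → ℕ} (ha : LexUnivoque M a)
    (hlast : a (m - 1) < M) (hpre : IsStrictPrefix a m) (y : ℕ → Bool) :
    LexUnivoque M (tune M m a (pairBits y)) := by
  have hs0 := pairBits_zero y
  have hs := pairBits_one_to_three y
  have hdecomp : ∀ n, ∃ i k, n = i * m + k ∧ k < m := fun n =>
    ⟨n / m, n % m, by rw [mul_comm]; exact (Nat.div_add_mod n m).symm, Nat.mod_lt n hm⟩
  refine ⟨tune_le ha.le hlast _, fun n => ?_, fun n => ?_⟩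
  · obtain ⟨i, k, hn, hk⟩ := hdecomp (n + 1)
    have e : (fun l => tune M m a (pairBits y) (n + 1 + l)) =
        fun l => tune M m a (fun l => pairBits y (i + l)) (k + l) := by
      ext l
      rw [hn, add_assoc, tune_shift hm]
    rw [e]
    rcases Nat.eq_zero_or_pos k with rfl | hk0
    · simp only [zero_add]
      refine tune_lt hm ha hlast hs0 hs fun h0 => ?_
      have hi : i ≠ 0 := by rintro rfl; omega
      simp only [add_zero] at h0
      refine exists_pairBits y false ?_
      by_contra hc
      rw [hs i (by omega) (by omega)] at h0
      exact absurd h0 (by simp)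
    · exact tune_tail_lt ha hlast hpre hs0 (hs 1 le_rfl (by omega)) hk0 hk
  · obtain ⟨i, k, hn, hk⟩ := hdecomp n
    have e : (fun l => M - tune M m a (pairBits y) (n + l)) =
        fun l => tune M m a (fun l => !pairBits y (i + l)) (k + l) := by
      ext l
      rw [hn, add_assoc, tune_shift hm, tune_not ha.le hlast]
    rw [e]
    rcases Nat.eq_zero_or_pos k with rfl | hk0
    · simp only [zero_add]
      refine tune_lt hm ha hlast hs0 hs fun h0 => ?_
      simp only [add_zero, Bool.not_eq_false'] at h0
      have hi : i ≠ 0 := by rintro rfl; simp [hs0] at h0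
      rcases Nat.lt_or_ge i 3 with h3 | h3
      · exact ⟨1, le_rfl, by omega, by simp [hs (i + 1) (by omega) (by omega)]⟩
      · obtain ⟨j, h1, h2, h⟩ := exists_pairBits y true h3
        exact ⟨j, h1, h2, by simp [h]⟩
    · exact tune_tail_lt ha hlast hpre hs0 (hs 1 le_rfl (by omega)) hk0 hk

lemma piQ_lipschitz {M : ℕ} {q : ℝ} (hq : 1 < q) : ∃ C : ℝ, 0 < C ∧ ∀ d : ℕ → ℕ,
    (∀ i, d i ≤ M) → ∀ p p' : ℝ, q ≤ p → q ≤ p' → |piQ p d - piQ p' d| ≤ C * |p - p'| := by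
  have hq0 : 0 < q := by linarith
  have hs : Summable fun i : ℕ => (M : ℝ) * ((i + 1 : ℕ) * (q⁻¹) ^ i) := by
    have h1 := summable_pow_mul_geometric_of_norm_lt_one (R := ℝ) 1 (r := q⁻¹) (by
      rw [Real.norm_of_nonneg (by positivity)]; exact inv_lt_one_of_one_lt₀ hq)
    have h2 := (summable_nat_add_iff 1).2 h1
    refine (h2.mul_left (q * M)).congr fun i => ?_
    rw [pow_one, pow_succ]
    field_simp
  refine ⟨∑' i : ℕ, (M : ℝ) * ((i + 1 : ℕ) * (q⁻¹) ^ i) + 1,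
    add_pos_of_nonneg_of_pos (tsum_nonneg fun i => by positivity) one_pos,
    fun d hd p p' hp hp' => ?_⟩
  have hp1 : 1 < p := by linarith
  have hp1' : 1 < p' := by linarith
  have hinv : |p⁻¹ - p'⁻¹| ≤ |p - p'| := by
    rw [inv_sub_inv (by positivity) (by positivity), abs_div, abs_sub_comm p' p,
      abs_of_pos (by positivity : 0 < p * p')]
    exact div_le_self (abs_nonneg _) (by nlinarith)
  have hterm : ∀ i, ‖(d i : ℝ) / p ^ (i + 1) - d i / p' ^ (i + 1)‖ ≤
      (M : ℝ) * ((i + 1 : ℕ) * (q⁻¹) ^ i) * |p - p'| := by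
    intro i
    have e : (d i : ℝ) / p ^ (i + 1) - d i / p' ^ (i + 1) =
        d i * ((p⁻¹) ^ (i + 1) - (p'⁻¹) ^ (i + 1)) := by
      rw [inv_pow, inv_pow]; ring
    rw [e, norm_mul, Real.norm_natCast, Real.norm_eq_abs]
    have h1 := abs_pow_sub_pow_le p⁻¹ p'⁻¹ (i + 1)
    have h2 : max |p⁻¹| |p'⁻¹| ≤ q⁻¹ := by
      rw [abs_of_pos (by positivity), abs_of_pos (by positivity)]
      exact max_le (by gcongr) (by gcongr)
    have h3 : (d i : ℝ) ≤ M := by exact_mod_cast hd i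
    have h4 : 0 ≤ max |p⁻¹| |p'⁻¹| := le_max_of_le_left (abs_nonneg _)
    rw [Nat.add_sub_cancel] at h1
    calc (d i : ℝ) * |p⁻¹ ^ (i + 1) - p'⁻¹ ^ (i + 1)|
        ≤ M * (|p - p'| * (i + 1 : ℕ) * (q⁻¹) ^ i) := by
          gcongr
          refine h1.trans ?_
          gcongr
      _ = _ := by ring
  have hs' := hs.mul_right |p - p'|
  unfold piQ
  rw [← (summable_digits hp1 hd).tsum_sub (summable_digits hp1' hd), ← Real.norm_eq_abs]
  refine (tsum_of_norm_bounded hs'.hasSum hterm).trans ?_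
  rw [tsum_mul_right]
  gcongr
  linarith

lemma continuousOn_piQ {M : ℕ} {q : ℝ} (hq : 1 < q) {d : ℕ → ℕ} (hd : ∀ i, d i ≤ M) :
    ContinuousOn (fun p => piQ p d) (Ici q) := by
  obtain ⟨C, hC, h⟩ := piQ_lipschitz (M := M) hq
  refine LipschitzOnWith.continuousOn (K := C.toNNReal) ?_
  refine LipschitzOnWith.of_dist_le_mul fun x hx y hy => ?_
  rw [Real.dist_eq, Real.dist_eq, Real.coe_toNNReal _ hC.le]
  exact h d hd x y hx hy

lemma piQ_strictAnti {M : ℕ} {p r : ℝ} (hp : 1 < p) (hpr : p < r) {d : ℕ → ℕ}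
    (hd : ∀ i, d i ≤ M) (hpos : 0 < piQ p d) : piQ r d < piQ p d := by
  have hr : 1 < r := hp.trans hpr
  have hle : ∀ i, (d i : ℝ) / r ^ (i + 1) ≤ d i / p ^ (i + 1) := fun i => by gcongr
  obtain ⟨i, hi⟩ : ∃ i, d i ≠ 0 := by
    by_contra! h
    simp [piQ, h] at hpos
  refine Summable.tsum_lt_tsum (i := i) hle ?_ (summable_digits hr hd) (summable_digits hp hd)
  have : (0 : ℝ) < d i := by exact_mod_cast Nat.pos_of_ne_zero hi
  gcongr

/-- A sequence slightly above the expansion `a` of `1` in base `q` expands `1` in a base slightly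
above `q`. -/
lemma exists_base {M : ℕ} {q r : ℝ} (hq : 1 < q) (hqr : q < r) {a : ℕ → ℕ}
    (ha : IsExpansion M q 1 a) (hx : ∀ n, piQ q (fun i => a (n + 1 + i)) < 1) :
    ∃ N, ∀ c : ℕ → ℕ, (∀ i, c i ≤ M) → (∀ i < N, c i = a i) → seqLt a c →
      ∃ p ∈ Ioo q r, piQ p c = 1 := by
  have hr : 1 < r := hq.trans hqr
  have h1 : piQ r a < 1 := by
    have := piQ_strictAnti hq hqr ha.1 (by rw [ha.2]; exact one_pos)
    rwa [ha.2] at this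
  have hlim : Tendsto (fun k : ℕ => (M : ℝ) / (r - 1) * (r⁻¹) ^ k) atTop (nhds 0) := by
    have := (tendsto_pow_atTop_nhds_zero_of_lt_one (r := r⁻¹) (by positivity)
      (inv_lt_one_of_one_lt₀ hr)).const_mul ((M : ℝ) / (r - 1))
    simpa using this
  obtain ⟨N, hN⟩ := (hlim.eventually_lt_const (sub_pos.2 h1)).exists
  refine ⟨N, fun c hc hca hlt => ?_⟩
  have hqc : 1 < piQ q c := by
    have := piQ_lt_of_seqLt hq ha.1 hc hx hlt
    rwa [ha.2] at this
  have hrc : piQ r c < 1 := by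
    have h := piQ_sub_of_agree hr hc ha.1 hca
    have h2 := piQ_le hr (d := fun i => c (N + i)) fun i => hc _
    have h3 := piQ_nonneg hr fun i => a (N + i)
    have h4 : (piQ r (fun i => c (N + i)) - piQ r (fun i => a (N + i))) / r ^ N ≤
        M / (r - 1) * (r⁻¹) ^ N := by
      rw [inv_pow, ← div_eq_mul_inv]
      gcongr
      linarith
    linarith
  obtain ⟨p, hp, hpc⟩ := intermediate_value_Ioo' hqr.le
    ((continuousOn_piQ hq hc).mono Icc_subset_Ici_self) ⟨hrc, hqc⟩
  exact ⟨p, hp, hpc⟩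

/-- A set carrying a Hölder-expanding image of the unit interval has positive dimension. -/
lemma dimH_pos_of_expanding {S : Set ℝ} {g : ℝ → ℝ} (hg : ∀ t ∈ Ico (0 : ℝ) 1, g t ∈ S)
    {D : ℝ} {n : ℕ} (hn : 0 < n)
    (hexp : ∀ t ∈ Ico (0 : ℝ) 1, ∀ t' ∈ Ico (0 : ℝ) 1, |t - t'| ^ n ≤ D * |g t - g t'|) :
    0 < dimH S := by
  have hinj : InjOn g (Ico 0 1) := by
    intro t ht t' ht' h
    have := hexp t ht t' ht'
    rw [h, sub_self, abs_zero, mul_zero] at this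
    have := pow_eq_zero_iff (hn.ne') |>.1 (le_antisymm this (by positivity))
    linarith [abs_eq_zero.1 this]
  let f := Function.invFunOn g (Ico 0 1)
  have hf : ∀ t ∈ Ico (0 : ℝ) 1, f (g t) = t := fun t ht => hinj.leftInvOn_invFunOn ht
  have hD : ∀ x : ℝ, D * |x| ≤ max D 0 * |x| := fun x => by
    gcongr
    exact le_max_left _ _
  have hD0 : 0 ≤ max D 0 := le_max_right _ _
  have hH : HolderOnWith (Real.toNNReal ((max D 0) ^ ((n : ℝ)⁻¹))) ((n : NNReal)⁻¹) f
      (g '' Ico 0 1) := by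
    rintro _ ⟨t, ht, rfl⟩ _ ⟨t', ht', rfl⟩
    rw [hf t ht, hf t' ht', edist_dist, edist_dist, Real.dist_eq, Real.dist_eq,
      ENNReal.ofReal_rpow_of_nonneg (abs_nonneg _) (by positivity)]
    change _ ≤ ENNReal.ofReal _ * _
    rw [← ENNReal.ofReal_mul (by positivity)]
    apply ENNReal.ofReal_le_ofReal
    have h := (hexp t ht t' ht').trans (hD _)
    rw [NNReal.coe_inv, NNReal.coe_natCast, ← Real.mul_rpow hD0 (abs_nonneg _)]
    calc |t - t'| = (|t - t'| ^ n) ^ ((n : ℝ)⁻¹) :=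
          (Real.pow_rpow_inv_natCast (abs_nonneg _) hn.ne').symm
      _ ≤ _ := by gcongr
  have himg : f '' (g '' Ico 0 1) = Ico 0 1 := by
    rw [image_image]
    ext x
    constructor
    · rintro ⟨t, ht, rfl⟩
      simpa [hf t ht] using ht
    · exact fun hx => ⟨x, hx, hf x hx⟩
  have h1 := hH.dimH_image_le (by positivity)
  rw [himg, Real.dimH_of_nonempty_interior (by simp)] at h1
  have h2 : dimH (g '' Ico 0 1) ≤ dimH S := dimH_mono (by
    rintro _ ⟨t, ht, rfl⟩
    exact hg t ht)
  refine lt_of_lt_of_le ?_ h2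
  rw [pos_iff_ne_zero]
  intro h0
  rw [h0] at h1
  simp at h1

/-- If the bit sequences `y`, `y'` first differ at `k`, the bases in which their tuned sequences expand `1`
are at distance at least a constant times `(M + 1) ^ (-2 m k)`. -/
lemma base_separation {M m : ℕ} (hm : 0 < m) {a : ℕ → ℕ} (ha : LexUnivoque M a)
    (hlast : a (m - 1) < M) (hpre : IsStrictPrefix a m) (hmid : ∀ y, tune M m a (pairBits y) m < M)
    {C q : ℝ} (hC : ∀ d : ℕ → ℕ,
    (∀ i, d i ≤ M) → ∀ p p' : ℝ, q ≤ p → q ≤ p' → |piQ p d - piQ p' d| ≤ C * |p - p'|)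
    (hq : 1 < q) {y y' : ℕ → Bool} {k : ℕ} (hyy : ∀ i < k, y i = y' i) (hne : y k ≠ y' k)
    {p p' : ℝ} (hp : q ≤ p) (hp' : q ≤ p') (hpM : p ≤ M + 1) (hpM' : p' ≤ M + 1)
    (h1 : piQ p (tune M m a (pairBits y)) = 1) (h1' : piQ p' (tune M m a (pairBits y')) = 1) :
    1 ≤ C * |p - p'| * ((M : ℝ) + 1) ^ (5 * m + 1 + 2 * m * k) := by
  have main : ∀ {y y' : ℕ → Bool} {p p' : ℝ} (hp : q ≤ p) (hp' : q ≤ p') (hpM : p ≤ M + 1)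
      (h1 : piQ p (tune M m a (pairBits y)) = 1) (h1' : piQ p' (tune M m a (pairBits y')) = 1),
      (∀ n < (3 + 2 * k) * m + (m - 1), tune M m a (pairBits y) n = tune M m a (pairBits y') n) →
      tune M m a (pairBits y) ((3 + 2 * k) * m + (m - 1)) <
        tune M m a (pairBits y') ((3 + 2 * k) * m + (m - 1)) →
      1 ≤ C * |p - p'| * ((M : ℝ) + 1) ^ (5 * m + 1 + 2 * m * k) := by
    intro y y' p p' hp hp' hpM h1 h1' hag hlt
    have hp1 : 1 < p := by linarith
    have hgap := (lexUnivoque_tune hm ha hlast hpre y).piQ_gap hp1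
      (lexUnivoque_tune hm ha hlast hpre y') (hmid y) (hmid y') h1 hag hlt
    have hl := (le_abs_self _).trans (hC _ (lexUnivoque_tune hm ha hlast hpre y').le p p' hp hp')
    rw [h1'] at hl
    have h := hgap.trans hl
    have e : (3 + 2 * k) * m + (m - 1) + m + 2 = 5 * m + 1 + 2 * m * k := by
      have : (3 + 2 * k) * m = 3 * m + 2 * m * k := by ring
      omega
    rw [e, div_le_iff₀ (by positivity)] at h
    have hCp : 0 ≤ C * |p - p'| := le_trans (abs_nonneg _) (hC (fun _ => 0) (by simp) p p' hp hp')
    refine h.trans ?_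
    gcongr
  have hag : ∀ l ≤ 3 + 2 * k, pairBits y l = pairBits y' l := by
    intro l hl
    by_cases h0 : l = 0
    · simp [h0, pairBits]
    by_cases h4 : l < 4
    · simp [h0, h4, pairBits]
    · simp only [pairBits, if_neg h0, if_neg h4, hyy ((l - 4) / 2) (by omega)]
  have e : 3 + 2 * k + 1 = 4 + 2 * k := by ring
  cases hy : y k
  · have hy' : y' k = true := by
      rw [hy] at hne
      simpa using hne.symm
    obtain ⟨h2, h3⟩ := tune_first_diff (M := M) hm (a := a) hlast hag
      (by rw [e, pairBits_even, hy]) (by rw [e, pairBits_even, hy'])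
    exact main hp hp' hpM h1 h1' h2 h3
  · have hy' : y' k = false := by
      rw [hy] at hne
      simpa using hne.symm
    obtain ⟨h2, h3⟩ := tune_first_diff (M := M) hm (a := a) hlast (fun l hl => (hag l hl).symm)
      (by rw [e, pairBits_even, hy']) (by rw [e, pairBits_even, hy])
    rw [abs_sub_comm]
    exact main hp' hp hpM' h1' h1 h2 h3

/-- If `q ∈ U`, then for every `r ∈ (q, M+1]` the Hausdorff dimension of
`U ∩ (q, r)` is strictly positive. -/
theorem stmt2 (M : ℕ) (hM : 0 < M) (q : ℝ) (hq : q ∈ Ioc 1 ((M : ℝ) + 1))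
    (hqU : q ∈ UnivBases M) :
    ∀ r ∈ Ioc q ((M : ℝ) + 1), 0 < dimH (UnivBases M ∩ Ioo q r) := by
  rintro r ⟨hqr, hrM⟩
  obtain ⟨hq1, -, a, haE, hu⟩ := hqU
  have hqM : q < M + 1 := hqr.trans_le hrM
  have hx := (tails_lt_one hq1 hqM haE hu).1
  have ha := lexUnivoque_of_unique hq1 hqM haE hu
  obtain ⟨N, hN⟩ := exists_base hq1 hqr haE hx
  obtain ⟨m, hNm, hlast, hpre⟩ := ha.exists_strictPrefix N
  have hm : 0 < m := by omega
  have ha0 : 0 < a 0 := by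
    have h := hx 0
    rw [piQ_step hq1 haE.1] at h
    simp only [zero_add, haE.2] at h
    have : (0 : ℝ) < a 0 := by linarith
    exact_mod_cast this
  have hmid : ∀ y, tune M m a (pairBits y) m < M := by
    intro y
    have h := tune_block (M := M) (m := m) a (pairBits y) 1 (k := 0) hm
    rw [one_mul, add_zero, pairBits_one_to_three y 1 le_rfl (by omega), if_pos rfl] at h
    rw [h]
    omega
  have hpre0 : ∀ y, ∀ l < m, tune M m a (pairBits y) l = a l + if l + 1 = m then 1 else 0 := by
    intro y l hl
    rw [tune_zero a _ hl, pairBits_zero, pairBits_one_to_three y 1 le_rfl (by omega)]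
    simp
  have hbase : ∀ y, ∃ p ∈ Ioo q r, piQ p (tune M m a (pairBits y)) = 1 := by
    intro y
    refine hN _ (tune_le haE.1 hlast _) (fun i hi => ?_) ⟨m - 1, fun i hi => ?_, ?_⟩
    · rw [hpre0 y i (by omega), if_neg (by omega), add_zero]
    · rw [hpre0 y i (by omega), if_neg (by omega), add_zero]
    · rw [hpre0 y (m - 1) (by omega), if_pos (by omega)]
      omega
  choose P hP hP1 using hbase
  obtain ⟨C, hC0, hC⟩ := piQ_lipschitz (M := M) hq1
  let Y : ℝ → ℕ → Bool := fun t i => decide (Real.digits t 2 i = 1)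
  obtain ⟨n, hn⟩ := pow_unbounded_of_one_lt (((M : ℝ) + 1) ^ (2 * m)) (one_lt_two)
  refine dimH_pos_of_expanding (g := fun t => P (Y t)) (D := C * ((M : ℝ) + 1) ^ (5 * m + 1))
    (n := n + 1) (fun t _ => ⟨?_, hP _⟩) (by omega) fun t ht t' ht' => ?_
  · exact (lexUnivoque_tune hm ha hlast hpre (Y t)).mem_univBases (hq1.trans (hP _).1)
      ((hP _).2.le.trans hrM) (hmid _) (hP1 _)
  · by_cases hd : Real.digits t 2 = Real.digits t' 2
    · have : t = t' := by
        rw [← Real.ofDigits_digits one_lt_two ht, ← Real.ofDigits_digits one_lt_two ht', hd]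
      rw [this]
      simp
    · classical
      have hex := Function.ne_iff.1 hd
      have hmin : ∀ i < Nat.find hex, Real.digits t 2 i = Real.digits t' 2 i :=
        fun i hi => not_not.1 (Nat.find_min hex hi)
      have hspec := Nat.find_spec hex
      generalize Nat.find hex = k at hmin hspec
      have hclose : |t - t'| ≤ ((2 : ℝ) ^ k)⁻¹ := by
        have := Real.abs_ofDigits_sub_ofDigits_le hmin
        rw [Real.ofDigits_digits one_lt_two ht, Real.ofDigits_digits one_lt_two ht'] at this
        exact_mod_cast this
      have hsep := base_separation hm ha hlast hpre hmid hC hq1 (y := Y t) (y' := Y t') (k := k)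
        (fun i hi => by simp only [Y, hmin i hi])
        (by
          simp only [Y, ne_eq, decide_eq_decide]
          generalize Real.digits t 2 k = u at *
          generalize Real.digits t' 2 k = v at *
          revert u v
          decide)
        (hP _).1.le (hP _).1.le ((hP _).2.le.trans hrM) ((hP _).2.le.trans hrM) (hP1 _) (hP1 _)
      set δ := |P (Y t) - P (Y t')|
      have hpow : (((M : ℝ) + 1) ^ (2 * m)) ^ k ≤ ((2 : ℝ) ^ k) ^ (n + 1) := by
        rw [← pow_mul (2 : ℝ), mul_comm k, pow_mul (2 : ℝ)]
        gcongr
        exact hn.le.trans (pow_le_pow_right₀ one_le_two (Nat.le_succ n))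
      have hCδ : 0 ≤ C * δ := by positivity
      calc |t - t'| ^ (n + 1) ≤ (((2 : ℝ) ^ k)⁻¹) ^ (n + 1) := by gcongr
        _ = (((2 : ℝ) ^ k) ^ (n + 1))⁻¹ := inv_pow _ _
        _ ≤ C * ((M : ℝ) + 1) ^ (5 * m + 1) * δ := by
          rw [inv_le_iff_one_le_mul₀ (by positivity)]
          refine hsep.trans ?_
          rw [pow_add, pow_mul ((M : ℝ) + 1) (2 * m) k]
          calc C * δ * (((M : ℝ) + 1) ^ (5 * m + 1) * (((M : ℝ) + 1) ^ (2 * m)) ^ k)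
              ≤ C * δ * (((M : ℝ) + 1) ^ (5 * m + 1) * ((2 : ℝ) ^ k) ^ (n + 1)) := by gcongr
            _ = _ := by ring

end
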